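/- Let K be a number field, q a prime, h an integer with 0 < h < q, x > 0 a real number, and ρ > 0 a real number. Then Σ_{n ≤ x} (x² − n²)^ρ Σ_{r | n} f_K(n/r) cos(2πrh/q) = (q^{2ρ+1}/φ(q)) Σ_{n ≤ x/q} ((x/q)² − n²)^ρ D_K(n) − (1/φ(q)) Σ_{n ≤ x} (x² − n²)^ρ D_K(n) + (1/φ(q)) Σ_{χ even, χ ≠ χ₀ mod q} χ(h) G(χ̄) Σ_{n ≤ x} (x² − n²)^ρ D_{K,χ}(n), where the middle sum over characters runs over all even nonprincipal Dirichlet characters χ modulo q. -/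

import Mathlib

open scoped Real Classical
open Filter Asymptotics NumberField

/-- `f_K(n)`: the number of nonzero integral ideals of `𝓞 K` of absolute norm `n`. -/
noncomputable def idealCount (K : Type*) [Field K] [NumberField K] (n : ℕ) : ℕ :=
  Nat.card {I : Ideal (𝓞 K) // I ≠ ⊥ ∧ Ideal.absNorm I = n}

/-- `D_K(n) = ∑_{d ∣ n} f_K(d)`. -/
noncomputable def DK (K : Type*) [Field K] [NumberField K] (n : ℕ) : ℕ :=
  ∑ d ∈ n.divisors, idealCount K d

/-- `D_{K,χ}(n) = ∑_{d ∣ n} f_K(d) χ(n/d)`. -/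
noncomputable def DKchi (K : Type*) [Field K] [NumberField K] {q : ℕ}
    (χ : DirichletCharacter ℂ q) (n : ℕ) : ℂ :=
  ∑ d ∈ n.divisors, (idealCount K d : ℂ) * χ ((n / d : ℕ) : ZMod q)

/-- Gauss sum `G(χ) = ∑_{h=1}^{q-1} χ(h) e^{2πih/q}`. -/
noncomputable def gaussSum' {q : ℕ} (χ : DirichletCharacter ℂ q) : ℂ :=
  ∑ h ∈ Finset.Ico 1 q, χ (h : ZMod q) * Complex.exp (2 * π * Complex.I * h / q)

lemma gaussSum'_eq_sum_stdAddChar {q : ℕ} [NeZero q] [Nontrivial (ZMod q)]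
    (χ : DirichletCharacter ℂ q) :
    gaussSum' χ = ∑ a : ZMod q, χ a * ZMod.stdAddChar a := by
  have hrange : ∑ a : ZMod q, χ a * ZMod.stdAddChar a
      = ∑ k ∈ Finset.range q, χ (k : ZMod q) * ZMod.stdAddChar (k : ZMod q) := by
    refine Finset.sum_bij' (fun a _ => a.val) (fun k _ => (k : ZMod q)) ?_ ?_ ?_ ?_ ?_
    · intro a _
      exact Finset.mem_range.2 (ZMod.val_lt a)
    · simp
    · simp
    · intro k hk
      exact ZMod.val_cast_of_lt (Finset.mem_range.1 hk)
    · simp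
  rw [hrange, Finset.range_eq_Ico, Finset.sum_eq_sum_Ico_succ_bot (NeZero.pos q), gaussSum']
  simp only [Nat.cast_zero, MulChar.map_zero, zero_mul, zero_add]
  refine Finset.sum_congr rfl fun k _ => ?_
  have := ZMod.stdAddChar_coe (N := q) (k : ℤ)
  push_cast at this
  rw [this]

lemma sum_inv_char_mul_char_eq {q : ℕ} [Fact q.Prime] (a : ZMod q) {b : ZMod q} (hb : b ≠ 0) :
    ∑ χ : DirichletCharacter ℂ q, χ⁻¹ a * χ b = if a = b then (q.totient : ℂ) else 0 := by
  by_cases ha : a = 0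
  · subst ha
    simp [MulChar.map_zero, hb.symm]
  · rw [← DirichletCharacter.sum_char_inv_mul_char_eq ℂ (isUnit_iff_ne_zero.2 ha) b]
    simp only [MulChar.inv_apply']

lemma sum_even_char_mul_gaussSum {q : ℕ} [Fact q.Prime] {b : ZMod q} (hb : b ≠ 0) :
    ∑ χ ∈ Finset.univ.filter (fun χ : DirichletCharacter ℂ q => χ.Even),
        χ b * gaussSum' χ⁻¹
      = q.totient * ((ZMod.stdAddChar b + ZMod.stdAddChar (-b)) / 2) := by
  have hall (c : ZMod q) (hc : c ≠ 0) :
      ∑ χ : DirichletCharacter ℂ q, χ c * gaussSum' χ⁻¹ = q.totient * ZMod.stdAddChar c := by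
    simp_rw [gaussSum'_eq_sum_stdAddChar, Finset.mul_sum]
    rw [Finset.sum_comm]
    have (a : ZMod q) : ∑ χ : DirichletCharacter ℂ q, χ c * (χ⁻¹ a * ZMod.stdAddChar a)
        = (if a = c then (q.totient : ℂ) else 0) * ZMod.stdAddChar a := by
      rw [← sum_inv_char_mul_char_eq a hc, Finset.sum_mul]
      exact Finset.sum_congr rfl fun χ _ => by ring
    simp [this]
  have hpar (χ : DirichletCharacter ℂ q) :
      (if χ.Even then χ b * gaussSum' χ⁻¹ else 0)
        = (χ b * gaussSum' χ⁻¹ + χ (-b) * gaussSum' χ⁻¹) / 2 := by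
    split_ifs with hχ
    · rw [hχ.eval_neg]
      ring
    · rw [(χ.even_or_odd.resolve_left hχ).eval_neg]
      ring
  rw [Finset.sum_filter, Finset.sum_congr rfl fun χ _ => hpar χ, ← Finset.sum_div,
    Finset.sum_add_distrib, hall b hb, hall (-b) (neg_ne_zero.2 hb)]
  ring

lemma gaussSum'_one {q : ℕ} [Fact q.Prime] :
    gaussSum' (1 : DirichletCharacter ℂ q) = -1 := by
  have hne : (ZMod.stdAddChar : AddChar (ZMod q) ℂ) ≠ 1 := by
    simpa using ZMod.isPrimitive_stdAddChar q one_ne_zero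
  have hsum : ∑ a : ZMod q, ZMod.stdAddChar a = (0 : ℂ) :=
    AddChar.sum_eq_zero_of_ne_one hne
  rw [gaussSum'_eq_sum_stdAddChar]
  have hterm (a : ZMod q) : (1 : DirichletCharacter ℂ q) a * ZMod.stdAddChar a
      = ZMod.stdAddChar a - if a = 0 then 1 else 0 := by
    split_ifs with ha
    · simp [ha, MulChar.map_zero]
    · rw [MulChar.one_apply (isUnit_iff_ne_zero.2 ha)]
      ring
  simp_rw [hterm, Finset.sum_sub_distrib, hsum]
  simp

lemma stdAddChar_add_neg_half {q : ℕ} [NeZero q] (m : ℕ) :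
    (ZMod.stdAddChar (m : ZMod q) + ZMod.stdAddChar (-(m : ZMod q))) / 2
      = (Real.cos (2 * π * m / q) : ℂ) := by
  have hp := ZMod.stdAddChar_coe (N := q) (m : ℤ)
  have hn := ZMod.stdAddChar_coe (N := q) (-m : ℤ)
  push_cast at hp hn
  rw [hp, hn, Complex.ofReal_cos, Complex.cos]
  push_cast
  congr 3 <;> ring

lemma ringHomComp_starRingEnd {q : ℕ} [NeZero q] (χ : DirichletCharacter ℂ q) :
    χ.ringHomComp (starRingEnd ℂ) = χ⁻¹ := by
  ext a
  exact MulChar.star_apply' χ _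

lemma cos_eq_sum_even_char {q : ℕ} [hq : Fact q.Prime] {h : ℕ} (hh : (h : ZMod q) ≠ 0) (r : ℕ) :
    (Real.cos (2 * π * r * h / q) : ℂ)
      = q / q.totient * (if q ∣ r then 1 else 0) - 1 / q.totient
        + 1 / q.totient *
          ∑ χ ∈ Finset.univ.filter (fun χ : DirichletCharacter ℂ q => χ.Even ∧ χ ≠ 1),
            χ (h : ZMod q) * gaussSum' (χ.ringHomComp (starRingEnd ℂ)) * χ (r : ZMod q) := by
  have hφ : (q.totient : ℂ) ≠ 0 := by
    exact_mod_cast (Nat.totient_pos.2 hq.out.pos).ne'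
  simp_rw [ringHomComp_starRingEnd]
  split_ifs with hr
  · have hq0 : (q : ℝ) ≠ 0 := by exact_mod_cast hq.out.ne_zero
    have hz : (r : ZMod q) = 0 := (ZMod.natCast_eq_zero_iff r q).2 hr
    obtain ⟨k, rfl⟩ := hr
    have hcos : Real.cos (2 * π * (q * k : ℕ) * h / q) = 1 := by
      rw [← Real.cos_nat_mul_two_pi (k * h)]
      congr 1
      push_cast
      field_simp
    have hφ' : (q.totient : ℂ) = q - 1 := by
      rw [Nat.totient_prime hq.out, Nat.cast_sub hq.out.one_le, Nat.cast_one]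
    rw [hcos, hz]
    simp only [MulChar.map_zero, mul_zero, Finset.sum_const_zero, mul_one, add_zero]
    rw [← sub_div, ← hφ', div_self hφ, Complex.ofReal_one]
  · have hr0 : (r : ZMod q) ≠ 0 := fun h0 => hr ((ZMod.natCast_eq_zero_iff r q).1 h0)
    have hb : ((r * h : ℕ) : ZMod q) ≠ 0 := by
      push_cast
      exact mul_ne_zero hr0 hh
    have hmain := sum_even_char_mul_gaussSum hb
    rw [stdAddChar_add_neg_half] at hmain
    have hone : (1 : DirichletCharacter ℂ q) ∈
        Finset.univ.filter (fun χ : DirichletCharacter ℂ q => χ.Even) := by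
      refine Finset.mem_filter.2 ⟨Finset.mem_univ _, ?_⟩
      exact MulChar.one_apply isUnit_one.neg
    rw [← Finset.add_sum_erase _ _ hone, inv_one, gaussSum'_one,
      MulChar.one_apply (isUnit_iff_ne_zero.2 hb)] at hmain
    have hset : (Finset.univ.filter (fun χ : DirichletCharacter ℂ q => χ.Even)).erase 1
        = Finset.univ.filter (fun χ : DirichletCharacter ℂ q => χ.Even ∧ χ ≠ 1) := by
      ext χ
      simp [and_comm]
    have hsum : ∑ χ ∈ Finset.univ.filter (fun χ : DirichletCharacter ℂ q => χ.Even ∧ χ ≠ 1),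
          χ (h : ZMod q) * gaussSum' χ⁻¹ * χ (r : ZMod q)
        = ∑ χ ∈ Finset.univ.filter (fun χ : DirichletCharacter ℂ q => χ.Even ∧ χ ≠ 1),
          χ ((r * h : ℕ) : ZMod q) * gaussSum' χ⁻¹ := by
      refine Finset.sum_congr rfl fun χ _ => ?_
      push_cast
      rw [map_mul]
      ring
    rw [hset] at hmain
    have hcast : 2 * π * r * h / q = 2 * π * (r * h : ℕ) / q := by
      push_cast
      ring
    rw [hsum, hcast, eq_sub_of_add_eq' hmain]
    field_simp
    ring

lemma DKchi_eq_sum_divisors (K : Type*) [Field K] [NumberField K] {q : ℕ}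
    (χ : DirichletCharacter ℂ q) (n : ℕ) :
    DKchi K χ n = ∑ r ∈ n.divisors, (idealCount K (n / r) : ℂ) * χ (r : ZMod q) := by
  rw [DKchi, ← Nat.sum_div_divisors n]
  refine Finset.sum_congr rfl fun r hr => ?_
  obtain ⟨hd, h0⟩ := Nat.mem_divisors.1 hr
  rw [Nat.div_div_self hd h0]

lemma sum_divisors_idealCount_div_of_dvd (K : Type*) [Field K] [NumberField K] {q : ℕ}
    (hq : 0 < q) {n : ℕ} (hn : n ≠ 0) :
    ∑ r ∈ n.divisors, (if q ∣ r then idealCount K (n / r) else 0)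
      = if q ∣ n then DK K (n / q) else 0 := by
  rw [← Finset.sum_filter]
  split_ifs with hqn
  · obtain ⟨m, rfl⟩ := hqn
    rw [Nat.mul_div_cancel_left m hq, DK, ← Nat.sum_div_divisors m]
    symm
    refine Finset.sum_bij (fun r _ => q * r) ?_ ?_ ?_ ?_
    · intro r hr
      exact Finset.mem_filter.2 ⟨Nat.mem_divisors.2
        ⟨Nat.mul_dvd_mul_left q (Nat.dvd_of_mem_divisors hr), hn⟩, dvd_mul_right q r⟩
    · intro a _ b _ hab
      exact Nat.eq_of_mul_eq_mul_left hq hab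
    · intro s hs
      obtain ⟨hs, k, rfl⟩ := Finset.mem_filter.1 hs
      exact ⟨k, Nat.mem_divisors.2 ⟨Nat.dvd_of_mul_dvd_mul_left hq (Nat.dvd_of_mem_divisors hs),
        right_ne_zero_of_mul hn⟩, rfl⟩
    · intro r _
      rw [Nat.mul_div_mul_left _ _ hq]
  · refine Finset.sum_eq_zero fun r hr => absurd ?_ hqn
    obtain ⟨hr, hqr⟩ := Finset.mem_filter.1 hr
    exact hqr.trans (Nat.dvd_of_mem_divisors hr)

lemma sum_rpow_multiples {q : ℕ} (hq : 0 < q) (x ρ : ℝ) (F : ℕ → ℝ) :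
    ∑ n ∈ Finset.Icc 1 ⌊x⌋₊, (x ^ 2 - (n : ℝ) ^ 2) ^ ρ * (if q ∣ n then F (n / q) else 0)
      = (q : ℝ) ^ (2 * ρ) *
        ∑ n ∈ Finset.Icc 1 ⌊x / q⌋₊, ((x / q) ^ 2 - (n : ℝ) ^ 2) ^ ρ * F n := by
  have hq0 : (0 : ℝ) < q := by exact_mod_cast hq
  simp_rw [mul_ite, mul_zero]
  rw [← Finset.sum_filter, Finset.mul_sum, Nat.floor_div_natCast]
  symm
  refine Finset.sum_bij (fun n _ => q * n) ?_ ?_ ?_ ?_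
  · intro n hn
    obtain ⟨h1, h2⟩ := Finset.mem_Icc.1 hn
    refine Finset.mem_filter.2 ⟨Finset.mem_Icc.2 ⟨Nat.mul_pos hq h1, ?_⟩, dvd_mul_right q n⟩
    rw [mul_comm]
    exact (Nat.le_div_iff_mul_le hq).1 h2
  · intro a _ b _ hab
    exact Nat.eq_of_mul_eq_mul_left hq hab
  · intro s hs
    obtain ⟨hs, k, rfl⟩ := Finset.mem_filter.1 hs
    obtain ⟨h1, h2⟩ := Finset.mem_Icc.1 hs
    refine ⟨k, Finset.mem_Icc.2 ⟨Nat.pos_of_mul_pos_left h1, ?_⟩, rfl⟩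
    rw [Nat.le_div_iff_mul_le hq, mul_comm]
    exact h2
  · intro n hn
    obtain ⟨h1, h2⟩ := Finset.mem_Icc.1 hn
    have hnx : (n : ℝ) ≤ x / q := by
      rw [← Nat.floor_div_natCast] at h2
      exact (Nat.le_floor_iff' (Nat.one_le_iff_ne_zero.1 h1)).1 h2
    have hnonneg : 0 ≤ (x / q) ^ 2 - (n : ℝ) ^ 2 :=
      sub_nonneg.2 (pow_le_pow_left₀ n.cast_nonneg hnx 2)
    have hfac : x ^ 2 - ((q * n : ℕ) : ℝ) ^ 2 = (q : ℝ) ^ (2 : ℝ) * ((x / q) ^ 2 - (n : ℝ) ^ 2) := by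
      rw [Real.rpow_two]
      push_cast
      field_simp
    rw [hfac, Real.mul_rpow (by positivity) hnonneg, ← Real.rpow_mul hq0.le,
      Nat.mul_div_cancel_left n hq]
    ring

lemma sum_idealCount_mul_cos (K : Type*) [Field K] [NumberField K] {q : ℕ} [hq : Fact q.Prime]
    {h : ℕ} (hh : (h : ZMod q) ≠ 0) {n : ℕ} (hn : n ≠ 0) :
    ((∑ r ∈ n.divisors, (idealCount K (n / r) : ℝ) * Real.cos (2 * π * r * h / q) : ℝ) : ℂ)
      = q / q.totient * ((if q ∣ n then (DK K (n / q) : ℝ) else 0 : ℝ) : ℂ)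
        - 1 / q.totient * (DK K n : ℂ)
        + 1 / q.totient *
          ∑ χ ∈ Finset.univ.filter (fun χ : DirichletCharacter ℂ q => χ.Even ∧ χ ≠ 1),
            χ (h : ZMod q) * gaussSum' (χ.ringHomComp (starRingEnd ℂ)) * DKchi K χ n := by
  have hdvd : ((if q ∣ n then (DK K (n / q) : ℝ) else 0 : ℝ) : ℂ)
      = ∑ r ∈ n.divisors, (idealCount K (n / r) : ℂ) * (if q ∣ r then 1 else 0) := by
    have := congrArg (Nat.cast : ℕ → ℂ) (sum_divisors_idealCount_div_of_dvd K hq.out.pos hn)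
    push_cast at this
    simp only [mul_ite, mul_one, mul_zero, this]
    split_ifs <;> simp
  have hD : (DK K n : ℂ) = ∑ r ∈ n.divisors, (idealCount K (n / r) : ℂ) := by
    rw [DK, ← Nat.sum_div_divisors n]
    push_cast
    rfl
  have hchi : ∑ χ ∈ Finset.univ.filter (fun χ : DirichletCharacter ℂ q => χ.Even ∧ χ ≠ 1),
        χ (h : ZMod q) * gaussSum' (χ.ringHomComp (starRingEnd ℂ)) * DKchi K χ n
      = ∑ r ∈ n.divisors, (idealCount K (n / r) : ℂ) *
        ∑ χ ∈ Finset.univ.filter (fun χ : DirichletCharacter ℂ q => χ.Even ∧ χ ≠ 1),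
          χ (h : ZMod q) * gaussSum' (χ.ringHomComp (starRingEnd ℂ)) * χ (r : ZMod q) := by
    simp_rw [DKchi_eq_sum_divisors, Finset.mul_sum]
    rw [Finset.sum_comm]
    exact Finset.sum_congr rfl fun r _ => Finset.sum_congr rfl fun χ _ => by ring
  rw [hdvd, hD, hchi, Complex.ofReal_sum, Finset.mul_sum, Finset.mul_sum, Finset.mul_sum,
    ← Finset.sum_sub_distrib, ← Finset.sum_add_distrib]
  refine Finset.sum_congr rfl fun r _ => ?_
  rw [Complex.ofReal_mul, cos_eq_sum_even_char hh r, Complex.ofReal_natCast]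
  ring

theorem statement2 (K : Type*) [Field K] [NumberField K]
    (q : ℕ) (hq : q.Prime) (h : ℕ) (hh0 : 0 < h) (hhq : h < q)
    (x : ℝ) (hx : 0 < x) (ρ : ℝ) (hρ : 0 < ρ) :
    ((∑ n ∈ Finset.Icc 1 ⌊x⌋₊, (x ^ 2 - (n : ℝ) ^ 2) ^ ρ *
        ∑ r ∈ n.divisors, (idealCount K (n / r) : ℝ) * Real.cos (2 * π * r * h / q) : ℝ) : ℂ)
    = (((q : ℝ) ^ (2 * ρ + 1) / (q.totient : ℝ) : ℝ) : ℂ) *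
        ((∑ n ∈ Finset.Icc 1 ⌊x / q⌋₊, ((x / q) ^ 2 - (n : ℝ) ^ 2) ^ ρ * (DK K n : ℝ) : ℝ) : ℂ)
      - (1 / (q.totient : ℂ)) *
        ((∑ n ∈ Finset.Icc 1 ⌊x⌋₊, (x ^ 2 - (n : ℝ) ^ 2) ^ ρ * (DK K n : ℝ) : ℝ) : ℂ)
      + (1 / (q.totient : ℂ)) *
        ∑ χ ∈ Finset.univ.filter (fun χ : DirichletCharacter ℂ q => χ.Even ∧ χ ≠ 1),
          χ (h : ZMod q) * gaussSum' (χ.ringHomComp (starRingEnd ℂ)) *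
          ∑ n ∈ Finset.Icc 1 ⌊x⌋₊, (((x ^ 2 - (n : ℝ) ^ 2) ^ ρ : ℝ) : ℂ) * DKchi K χ n := by
  set S := Finset.univ.filter (fun χ : DirichletCharacter ℂ q => χ.Even ∧ χ ≠ 1) with hS
  have : Fact q.Prime := ⟨hq⟩
  have hq0 : (0 : ℝ) < q := by exact_mod_cast hq.pos
  have hh : (h : ZMod q) ≠ 0 := fun h0 =>
    Nat.not_dvd_of_pos_of_lt hh0 hhq ((ZMod.natCast_eq_zero_iff h q).1 h0)
  have hS' : S = Finset.univ.filter (fun χ : DirichletCharacter ℂ q => χ.Even ∧ χ ≠ 1) := by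
    ext χ
    simp only [hS, Finset.mem_filter, Finset.mem_univ]
  rw [hS']
  have hmult : (((q : ℝ) ^ (2 * ρ + 1) / (q.totient : ℝ) : ℝ) : ℂ) *
        ((∑ n ∈ Finset.Icc 1 ⌊x / q⌋₊, ((x / q) ^ 2 - (n : ℝ) ^ 2) ^ ρ * (DK K n : ℝ) : ℝ) : ℂ)
      = q / q.totient * ((∑ n ∈ Finset.Icc 1 ⌊x⌋₊, (x ^ 2 - (n : ℝ) ^ 2) ^ ρ *
          (if q ∣ n then (DK K (n / q) : ℝ) else 0) : ℝ) : ℂ) := by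
    rw [sum_rpow_multiples hq.pos x ρ fun n => (DK K n : ℝ), Real.rpow_add hq0, Real.rpow_one]
    push_cast
    ring
  have hchi : ∑ χ ∈ Finset.univ.filter (fun χ : DirichletCharacter ℂ q => χ.Even ∧ χ ≠ 1),
        χ (h : ZMod q) * gaussSum' (χ.ringHomComp (starRingEnd ℂ)) *
          ∑ n ∈ Finset.Icc 1 ⌊x⌋₊, (((x ^ 2 - (n : ℝ) ^ 2) ^ ρ : ℝ) : ℂ) * DKchi K χ n
      = ∑ n ∈ Finset.Icc 1 ⌊x⌋₊, (((x ^ 2 - (n : ℝ) ^ 2) ^ ρ : ℝ) : ℂ) *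
        ∑ χ ∈ Finset.univ.filter (fun χ : DirichletCharacter ℂ q => χ.Even ∧ χ ≠ 1),
          χ (h : ZMod q) * gaussSum' (χ.ringHomComp (starRingEnd ℂ)) * DKchi K χ n := by
    simp_rw [Finset.mul_sum]
    rw [Finset.sum_comm]
    exact Finset.sum_congr rfl fun n _ => Finset.sum_congr rfl fun χ _ => by ring
  rw [hmult, hchi, Complex.ofReal_sum, Complex.ofReal_sum, Complex.ofReal_sum, Finset.mul_sum,
    Finset.mul_sum, Finset.mul_sum, ← Finset.sum_sub_distrib, ← Finset.sum_add_distrib]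
  refine Finset.sum_congr rfl fun n hn => ?_
  have hn0 : n ≠ 0 := Nat.one_le_iff_ne_zero.1 (Finset.mem_Icc.1 hn).1
  rw [Complex.ofReal_mul, sum_idealCount_mul_cos K hh hn0, Complex.ofReal_mul, Complex.ofReal_mul,
    Complex.ofReal_natCast]
  ring
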